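/- arXiv:2312.14019 — 2 statements merged into one kernel-verified Lean document; each statement's English description precedes it below -/
import Mathlib

section
/- Let Λ be a finite set, q ≥ 2, and consider complex matrices indexed by the function type Λ → Fin q (total dimension q^{|Λ|}). For S ⊆ Λ define the local algebra A_S := {X : there exists a matrix M indexed by (S → Fin q) such that for all x, y : Λ → Fin q, X x y = M(x|_S)(y|_S) if x and y agree on Λ∖S, and X x y = 0 otherwise}; each A_S is a hermitian-closed unital subalgebra. Then for all S₁, S₂ ⊆ Λ, S(A_{S₁} : A_{S₂}) = 1 − q^{−2|S₁ ∩ S₂|}; in particular the self-MAN satisfies S(A_S : A_S) = 1 − q^{−2|S|}. -/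
open MeasureTheory Matrix Kronecker

noncomputable section

instance matMeasurableSpace (n : Type*) [Fintype n] : MeasurableSpace (Matrix n n ℂ) :=
  show MeasurableSpace (n → n → ℂ) from inferInstance

/-- Squared Frobenius (Hilbert-Schmidt) norm `‖X‖₂² = Tr(X† X)`. -/
def hs2 {n : Type*} [Fintype n] (X : Matrix n n ℂ) : ℝ := (Matrix.trace (Xᴴ * X)).re

/-- Mutual Averaged Non-commutativity: `(1/(2d)) ∫∫ ‖UV - VU‖₂² dμ(U) dν(V)`,
where `μ`, `ν` are meant to be the normalized Haar measures of the unitary groups of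
the two algebras (imposed by the `IsHaar` hypotheses in the theorems below). -/
def MAN {n : Type*} [Fintype n] (μ ν : Measure (Matrix n n ℂ)) : ℝ :=
  (1 / (2 * (Fintype.card n : ℝ))) * ∫ U, ∫ V, hs2 (U * V - V * U) ∂ν ∂μ

/-- `μ` is the normalized Haar probability measure of the compact unitary group
`U(A) = {U ∈ A : U†U = UU† = 1}` of the star-subalgebra `A`, viewed as a measure on
matrix space concentrated on `U(A)` and invariant under left translation by `U(A)`. -/
def IsHaar {n : Type*} [Fintype n] [DecidableEq n] (A : StarSubalgebra ℂ (Matrix n n ℂ))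
    (μ : Measure (Matrix n n ℂ)) : Prop :=
  IsProbabilityMeasure μ ∧
  μ {U | ¬ (U ∈ A ∧ U ∈ unitary (Matrix n n ℂ))} = 0 ∧
  ∀ U ∈ A, U ∈ unitary (Matrix n n ℂ) → μ.map (fun V => U * V) = μ

/-- The local algebra `A_S` on region `S ⊆ Λ` of a lattice of `q`-dimensional sites. -/
def localCarrier (Λ : Type*) [Fintype Λ] [DecidableEq Λ] (q : ℕ) (S : Finset Λ) :
    Set (Matrix (Λ → Fin q) (Λ → Fin q) ℂ) :=
  {X | ∃ M : Matrix ({i // i ∈ S} → Fin q) ({i // i ∈ S} → Fin q) ℂ,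
    ∀ x y : Λ → Fin q,
      ((∀ i ∉ S, x i = y i) → X x y = M (fun i => x i.1) (fun i => y i.1)) ∧
      (¬ (∀ i ∉ S, x i = y i) → X x y = 0)}

section Helpers

variable {n : Type*} [Fintype n]

lemma measurable_matrix_entry (x y : n) : Measurable fun U : Matrix n n ℂ => U x y :=
  (measurable_pi_apply y).comp (measurable_pi_apply (X := fun _ : n => n → ℂ) x)

lemma measurable_matrix_of_entries {α : Type*} [MeasurableSpace α] {f : α → Matrix n n ℂ}
    (h : ∀ x y, Measurable fun a => f a x y) : Measurable f :=
  measurable_pi_iff.2 fun x => measurable_pi_iff.2 fun y => h x y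

lemma measurable_matrix_mul_left (W : Matrix n n ℂ) :
    Measurable fun U : Matrix n n ℂ => W * U := by
  refine measurable_matrix_of_entries fun x y => ?_
  simp only [Matrix.mul_apply]
  exact Finset.measurable_sum _ fun z _ => (measurable_matrix_entry z y).const_mul _

variable [DecidableEq n]

lemma measurableSet_unitary : MeasurableSet {U : Matrix n n ℂ | U ∈ unitary (Matrix n n ℂ)} := by
  have : {U : Matrix n n ℂ | U ∈ unitary (Matrix n n ℂ)} =
      ⋂ x, ⋂ y, {U | ∑ z, U x z * star (U y z) = (1 : Matrix n n ℂ) x y} := by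
    ext U
    rw [Set.mem_ofPred_eq, ← Matrix.unitaryGroup, Matrix.mem_unitaryGroup_iff, ← Matrix.ext_iff]
    simp [Matrix.mul_apply]
  rw [this]
  exact .iInter fun x => .iInter fun y => measurableSet_eq_fun (Finset.measurable_sum _ fun z _ =>
    (measurable_matrix_entry x z).mul
      (continuous_star.measurable.comp (measurable_matrix_entry y z))) measurable_const

lemma unitary_entry_norm_le_one {U : Matrix n n ℂ} (hU : U ∈ unitary (Matrix n n ℂ)) (x y : n) :
    ‖U x y‖ ≤ 1 := entry_norm_bound_of_unitary hU x y

lemma IsHaar.ae_mem {A : StarSubalgebra ℂ (Matrix n n ℂ)} {μ : Measure (Matrix n n ℂ)}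
    (h : IsHaar A μ) : ∀ᵐ U ∂μ, U ∈ A ∧ U ∈ unitary (Matrix n n ℂ) := h.2.1

lemma IsHaar.integrable_entry_mul {A : StarSubalgebra ℂ (Matrix n n ℂ)}
    {μ : Measure (Matrix n n ℂ)} (h : IsHaar A μ) (x y z w : n) :
    Integrable (fun U : Matrix n n ℂ => U x y * star (U z w)) μ := by
  have := h.1
  refine Integrable.of_bound (C := 1) ?_ ?_
  · exact ((measurable_matrix_entry x y).mul
      (continuous_star.measurable.comp (measurable_matrix_entry z w))).aestronglyMeasurable
  · filter_upwards [h.ae_mem] with U hU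
    rw [norm_mul, norm_star]
    exact mul_le_one₀ (unitary_entry_norm_le_one hU.2 x y) (norm_nonneg _)
      (unitary_entry_norm_le_one hU.2 z w)

lemma IsHaar.integral_mul_left {A : StarSubalgebra ℂ (Matrix n n ℂ)}
    {μ : Measure (Matrix n n ℂ)} (h : IsHaar A μ) {W : Matrix n n ℂ} (hWA : W ∈ A)
    (hW : W ∈ unitary (Matrix n n ℂ)) (x y z w : n) :
    ∫ U, (W * U) x y * star ((W * U) z w) ∂μ = ∫ U, U x y * star (U z w) ∂μ := by
  conv_rhs => rw [← h.2.2 W hWA hW]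
  rw [integral_map (measurable_matrix_mul_left W).aemeasurable]
  exact ((measurable_matrix_entry x y).mul
      (continuous_star.measurable.comp (measurable_matrix_entry z w))).aestronglyMeasurable

/-- Second moments of the normalized Haar measure of the full unitary group. -/
lemma IsHaar.integral_entry_mul_top {μ : Measure (Matrix n n ℂ)}
    (h : IsHaar (⊤ : StarSubalgebra ℂ (Matrix n n ℂ)) μ) (a b c d : n) :
    ∫ U, U a b * star (U c d) ∂μ = if a = c ∧ b = d then (Fintype.card n : ℂ)⁻¹ else 0 := by
  have := h.1
  by_cases hac : a = c
  · subst hac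
    have hperm (a' : n) : ∫ U, U a' b * star (U a' d) ∂μ = ∫ U, U a b * star (U a d) ∂μ := by
      have hW : (Equiv.swap a a').permMatrix ℂ ∈ unitary (Matrix n n ℂ) :=
        Matrix.mem_unitaryGroup_iff.2 (by
          rw [Matrix.star_eq_conjTranspose, Matrix.conjTranspose_permMatrix, ← Matrix.permMatrix_mul]
          simp)
      have := h.integral_mul_left (StarSubalgebra.mem_top) hW a b a d
      simpa [Equiv.Perm.permMatrix, PEquiv.toMatrix_toPEquiv_mul] using this
    have hsum : ∑ a', ∫ U, U a' b * star (U a' d) ∂μ = if b = d then 1 else 0 := by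
      rw [← integral_finsetSum _ fun a' _ => h.integrable_entry_mul a' b a' d]
      have : ∀ᵐ U ∂μ, ∑ a', U a' b * star (U a' d) = if b = d then (1 : ℂ) else 0 := by
        filter_upwards [h.ae_mem] with U hU
        have h0 : star U * U = 1 := Unitary.star_mul_self_of_mem hU.2
        have h1 := Matrix.ext_iff.2 h0 d b
        rw [Matrix.mul_apply, Matrix.one_apply] at h1
        simp only [eq_comm (a := b), ← h1, Matrix.star_apply, mul_comm]
      rw [integral_congr_ae this]
      simp
    simp only [hperm, Finset.sum_const, Finset.card_univ, nsmul_eq_mul] at hsum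
    have : (Fintype.card n : ℂ) ≠ 0 := by
      have : Nonempty n := ⟨a⟩
      exact_mod_cast Fintype.card_ne_zero
    rw [eq_comm, ← mul_right_inj' this, hsum]
    split_ifs <;> simp_all
  · have hW : Matrix.diagonal (fun i => if i = a then (-1 : ℂ) else 1)
        ∈ unitary (Matrix n n ℂ) := by
      refine Matrix.mem_unitaryGroup_iff.2 ?_
      rw [Matrix.star_eq_conjTranspose, Matrix.diagonal_conjTranspose, Matrix.diagonal_mul_diagonal,
        ← Matrix.diagonal_one]
      congr 1
      ext i
      simp only [Pi.star_apply]
      split_ifs <;> simp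
    have := h.integral_mul_left (StarSubalgebra.mem_top) hW a b c d
    simp only [Matrix.diagonal_mul, if_true, if_neg (Ne.symm hac), one_mul, neg_mul,
      integral_neg] at this
    rw [if_neg (by tauto)]
    exact self_eq_neg.1 this.symm

lemma hs2_commutator_of_unitary {U V : Matrix n n ℂ} (hU : U ∈ unitary (Matrix n n ℂ))
    (hV : V ∈ unitary (Matrix n n ℂ)) :
    hs2 (U * V - V * U) = 2 * Fintype.card n -
      2 * (∑ x, ∑ y, ∑ z, ∑ w, (U w x * star (U z y)) * (V z w * star (V y x))).re := by
  have h1 : (U * V)ᴴ * (U * V) = 1 := Unitary.star_mul_self_of_mem (mul_mem hU hV)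
  have h2 : (V * U)ᴴ * (V * U) = 1 := Unitary.star_mul_self_of_mem (mul_mem hV hU)
  have h3 : (Matrix.trace ((V * U)ᴴ * (U * V))).re = (Matrix.trace ((U * V)ᴴ * (V * U))).re := by
    rw [← Complex.conj_re, ← Complex.star_def, ← Matrix.trace_conjTranspose,
      Matrix.conjTranspose_mul, Matrix.conjTranspose_conjTranspose]
  have h4 : Matrix.trace ((U * V)ᴴ * (V * U)) =
      ∑ x, ∑ y, ∑ z, ∑ w, (U w x * star (U z y)) * (V z w * star (V y x)) := by
    rw [Matrix.conjTranspose_mul, Matrix.mul_assoc]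
    simp only [Matrix.trace, Matrix.diag, Matrix.mul_apply, Matrix.conjTranspose_apply,
      Finset.mul_sum]
    refine Finset.sum_congr rfl fun x _ => Finset.sum_congr rfl fun y _ =>
      Finset.sum_congr rfl fun z _ => Finset.sum_congr rfl fun w _ => ?_
    ring
  rw [hs2, Matrix.conjTranspose_sub, Matrix.sub_mul, Matrix.mul_sub, Matrix.mul_sub, h1, h2,
    ← h4]
  simp only [Matrix.trace_sub, Matrix.trace_one, Complex.sub_re, Complex.natCast_re, h3]
  ring

lemma MAN_eq_of_isHaar {A B : StarSubalgebra ℂ (Matrix n n ℂ)} [Nonempty n]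
    {μ ν : Measure (Matrix n n ℂ)} (hμ : IsHaar A μ) (hν : IsHaar B ν) :
    MAN μ ν = 1 - (∑ x, ∑ y, ∑ z, ∑ w, (∫ U, U w x * star (U z y) ∂μ) *
      ∫ V, V z w * star (V y x) ∂ν).re / Fintype.card n := by
  have := hμ.1
  have := hν.1
  have hinner : ∀ᵐ U ∂μ, ∫ V, hs2 (U * V - V * U) ∂ν = 2 * Fintype.card n -
      2 * (∑ x, ∑ y, ∑ z, ∑ w, (U w x * star (U z y)) * ∫ V, V z w * star (V y x) ∂ν).re := by
    filter_upwards [hμ.ae_mem] with U hU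
    have hint (x y z w : n) : Integrable
        (fun V : Matrix n n ℂ => (U w x * star (U z y)) * (V z w * star (V y x))) ν :=
      (hν.integrable_entry_mul z w y x).const_mul _
    have hI : Integrable (fun V : Matrix n n ℂ =>
        ∑ x, ∑ y, ∑ z, ∑ w, (U w x * star (U z y)) * (V z w * star (V y x))) ν :=
      integrable_finsetSum _ fun x _ => integrable_finsetSum _ fun y _ =>
        integrable_finsetSum _ fun z _ => integrable_finsetSum _ fun w _ => hint x y z w
    have hI' : Integrable (fun V : Matrix n n ℂ => 2 *
        (∑ x, ∑ y, ∑ z, ∑ w, (U w x * star (U z y)) * (V z w * star (V y x))).re) ν :=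
      hI.re.const_mul 2
    rw [integral_congr_ae (hν.ae_mem.mono fun V hV => hs2_commutator_of_unitary hU.2 hV.2),
      integral_sub (integrable_const _) hI', integral_const_mul, integral_const_mul]
    have hre := integral_re hI
    simp only [RCLike.re_eq_complex_re] at hre
    rw [hre]
    congr 3
    · simp
    · rw [integral_finsetSum _ fun x _ => integrable_finsetSum _ fun y _ =>
        integrable_finsetSum _ fun z _ => integrable_finsetSum _ fun w _ => hint x y z w]
      refine Finset.sum_congr rfl fun x _ => ?_
      rw [integral_finsetSum _ fun y _ =>
        integrable_finsetSum _ fun z _ => integrable_finsetSum _ fun w _ => hint x y z w]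
      refine Finset.sum_congr rfl fun y _ => ?_
      rw [integral_finsetSum _ fun z _ => integrable_finsetSum _ fun w _ => hint x y z w]
      refine Finset.sum_congr rfl fun z _ => ?_
      rw [integral_finsetSum _ fun w _ => hint x y z w]
      exact Finset.sum_congr rfl fun w _ => integral_const_mul _ _
  have hint (x y z w : n) : Integrable (fun U : Matrix n n ℂ =>
      (U w x * star (U z y)) * ∫ V, V z w * star (V y x) ∂ν) μ :=
    (hμ.integrable_entry_mul w x z y).mul_const _
  have hI : Integrable (fun U : Matrix n n ℂ =>
      ∑ x, ∑ y, ∑ z, ∑ w, (U w x * star (U z y)) * ∫ V, V z w * star (V y x) ∂ν) μ :=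
    integrable_finsetSum _ fun x _ => integrable_finsetSum _ fun y _ =>
      integrable_finsetSum _ fun z _ => integrable_finsetSum _ fun w _ => hint x y z w
  have hsum : ∫ U, ∑ x, ∑ y, ∑ z, ∑ w, (U w x * star (U z y)) *
      ∫ V, V z w * star (V y x) ∂ν ∂μ = ∑ x, ∑ y, ∑ z, ∑ w, (∫ U, U w x * star (U z y) ∂μ) *
      ∫ V, V z w * star (V y x) ∂ν := by
    rw [integral_finsetSum _ fun x _ => integrable_finsetSum _ fun y _ =>
      integrable_finsetSum _ fun z _ => integrable_finsetSum _ fun w _ => hint x y z w]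
    refine Finset.sum_congr rfl fun x _ => ?_
    rw [integral_finsetSum _ fun y _ =>
      integrable_finsetSum _ fun z _ => integrable_finsetSum _ fun w _ => hint x y z w]
    refine Finset.sum_congr rfl fun y _ => ?_
    rw [integral_finsetSum _ fun z _ => integrable_finsetSum _ fun w _ => hint x y z w]
    refine Finset.sum_congr rfl fun z _ => ?_
    rw [integral_finsetSum _ fun w _ => hint x y z w]
    exact Finset.sum_congr rfl fun w _ => integral_mul_const _ _
  have hre := integral_re hI
  simp only [RCLike.re_eq_complex_re] at hre
  have hI' : Integrable (fun U : Matrix n n ℂ => 2 *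
      (∑ x, ∑ y, ∑ z, ∑ w, (U w x * star (U z y)) * ∫ V, V z w * star (V y x) ∂ν).re) μ :=
    hI.re.const_mul 2
  rw [MAN, integral_congr_ae hinner, integral_sub (integrable_const _) hI', integral_const_mul,
    integral_const_mul, ← hsum, hre]
  have : (Fintype.card n : ℝ) ≠ 0 := by exact_mod_cast Fintype.card_ne_zero
  simp only [integral_const, probReal_univ, one_smul]
  field_simp

end Helpers

section Local

variable {Λ : Type*} [Fintype Λ] [DecidableEq Λ] {q : ℕ} (S : Finset Λ)

/-- Splitting of a configuration into its parts on `S` and off `S`. -/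
abbrev splitEquiv (q : ℕ) : (Λ → Fin q) ≃
    ({i // i ∈ S} → Fin q) × ({i // i ∉ S} → Fin q) :=
  Equiv.piEquivPiSubtypeProd (fun i => i ∈ S) fun _ => Fin q

/-- The operator `M ⊗ 1` on the lattice, with `M` acting on the region `S`. -/
def localLift (M : Matrix ({i // i ∈ S} → Fin q) ({i // i ∈ S} → Fin q) ℂ) :
    Matrix (Λ → Fin q) (Λ → Fin q) ℂ :=
  (M ⊗ₖ (1 : Matrix ({i // i ∉ S} → Fin q) ({i // i ∉ S} → Fin q) ℂ)).submatrix
    (splitEquiv S q) (splitEquiv S q)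

/-- The block on `S` of a lattice operator at a fixed configuration outside `S`. -/
def localBlock (o : {i // i ∉ S} → Fin q) (X : Matrix (Λ → Fin q) (Λ → Fin q) ℂ) :
    Matrix ({i // i ∈ S} → Fin q) ({i // i ∈ S} → Fin q) ℂ :=
  X.submatrix (fun a => (splitEquiv S q).symm (a, o)) fun a => (splitEquiv S q).symm (a, o)

lemma localLift_apply (M : Matrix ({i // i ∈ S} → Fin q) ({i // i ∈ S} → Fin q) ℂ)
    (x y : Λ → Fin q) : localLift S M x y =
      if ∀ i ∉ S, x i = y i then M (fun i => x i.1) (fun i => y i.1) else 0 := by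
  simp [localLift, Matrix.kroneckerMap_apply, Matrix.one_apply, funext_iff,
    Equiv.piEquivPiSubtypeProd]

lemma localBlock_localLift (o : {i // i ∉ S} → Fin q)
    (M : Matrix ({i // i ∈ S} → Fin q) ({i // i ∈ S} → Fin q) ℂ) :
    localBlock S o (localLift S M) = M := by
  ext a b
  simp [localLift, localBlock, Matrix.kroneckerMap_apply]

lemma localLift_mul (M N : Matrix ({i // i ∈ S} → Fin q) ({i // i ∈ S} → Fin q) ℂ) :
    localLift S (M * N) = localLift S M * localLift S N := by
  simp only [localLift]
  rw [Matrix.submatrix_mul_equiv, ← Matrix.mul_kronecker_mul, Matrix.one_mul]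

lemma localLift_star (M : Matrix ({i // i ∈ S} → Fin q) ({i // i ∈ S} → Fin q) ℂ) :
    localLift S (star M) = star (localLift S M) := by
  simp only [localLift, Matrix.star_eq_conjTranspose]
  rw [Matrix.conjTranspose_submatrix, Matrix.conjTranspose_kronecker, Matrix.conjTranspose_one]

lemma localLift_one : localLift S (1 : Matrix ({i // i ∈ S} → Fin q) _ ℂ) = 1 := by
  rw [localLift, Matrix.one_kronecker_one, Matrix.submatrix_one_equiv]

lemma localLift_mem_unitary_iff [NeZero q]
    {M : Matrix ({i // i ∈ S} → Fin q) ({i // i ∈ S} → Fin q) ℂ} :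
    localLift S M ∈ unitary (Matrix (Λ → Fin q) (Λ → Fin q) ℂ) ↔
      M ∈ unitary (Matrix ({i // i ∈ S} → Fin q) ({i // i ∈ S} → Fin q) ℂ) := by
  have hinj : Function.Injective (localLift S (q := q)) :=
    Function.LeftInverse.injective (localBlock_localLift S fun _ => 0)
  rw [Unitary.mem_iff, Unitary.mem_iff, ← localLift_star, ← localLift_mul, ← localLift_mul,
    ← localLift_one, hinj.eq_iff, hinj.eq_iff]

lemma mem_localCarrier_iff {X : Matrix (Λ → Fin q) (Λ → Fin q) ℂ} :
    X ∈ localCarrier Λ q S ↔ ∃ M, X = localLift S M := by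
  refine exists_congr fun M => ?_
  simp only [← Matrix.ext_iff, localLift_apply]
  refine forall₂_congr fun x y => ?_
  by_cases h : ∀ i ∉ S, x i = y i
  · rw [if_pos h]
    exact ⟨fun H => H.1 h, fun H => ⟨fun _ => H, fun h' => (h' h).elim⟩⟩
  · rw [if_neg h]
    exact ⟨fun H => H.2 h, fun H => ⟨fun h' => (h h').elim, fun _ => H⟩⟩

lemma measurable_localBlock (o : {i // i ∉ S} → Fin q) : Measurable (localBlock S o) :=
  measurable_matrix_of_entries fun _ _ => measurable_matrix_entry _ _

lemma isHaar_map_localBlock [NeZero q] {A : StarSubalgebra ℂ (Matrix (Λ → Fin q) (Λ → Fin q) ℂ)}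
    (hA : (A : Set (Matrix (Λ → Fin q) (Λ → Fin q) ℂ)) = localCarrier Λ q S)
    {μ : Measure (Matrix (Λ → Fin q) (Λ → Fin q) ℂ)} (h : IsHaar A μ)
    (o : {i // i ∉ S} → Fin q) : IsHaar ⊤ (μ.map (localBlock S o)) := by
  have := h.1
  have hm := measurable_localBlock S o
  have hlift : ∀ᵐ U ∂μ, ∃ M ∈ unitary (Matrix ({i // i ∈ S} → Fin q) _ ℂ),
      U = localLift S M := by
    filter_upwards [h.ae_mem] with U hU
    obtain ⟨M, rfl⟩ := (mem_localCarrier_iff S).1 (hA ▸ hU.1 : U ∈ localCarrier Λ q S)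
    exact ⟨M, (localLift_mem_unitary_iff S).1 hU.2, rfl⟩
  refine ⟨Measure.isProbabilityMeasure_map hm.aemeasurable, ?_, fun W _ hW => ?_⟩
  · rw [← ae_iff, ae_map_iff hm.aemeasurable]
    · filter_upwards [hlift] with U hU
      obtain ⟨M, hM, rfl⟩ := hU
      rw [localBlock_localLift]
      exact ⟨StarSubalgebra.mem_top, hM⟩
    · simpa using measurableSet_unitary
  · have hWA : localLift S W ∈ A := by
      rw [← SetLike.mem_coe, hA]
      exact (mem_localCarrier_iff S).2 ⟨W, rfl⟩
    rw [Measure.map_map (measurable_matrix_mul_left W) hm]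
    conv_rhs => rw [← h.2.2 _ hWA ((localLift_mem_unitary_iff S).2 hW),
      Measure.map_map hm (measurable_matrix_mul_left _)]
    refine Measure.map_congr ?_
    filter_upwards [hlift] with U hU
    obtain ⟨M, -, rfl⟩ := hU
    simp [← localLift_mul, localBlock_localLift]

/-- Second moments of the Haar measure of a local algebra factorize over sites. -/
lemma integral_entry_mul_local [NeZero q]
    {A : StarSubalgebra ℂ (Matrix (Λ → Fin q) (Λ → Fin q) ℂ)}
    (hA : (A : Set (Matrix (Λ → Fin q) (Λ → Fin q) ℂ)) = localCarrier Λ q S)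
    {μ : Measure (Matrix (Λ → Fin q) (Λ → Fin q) ℂ)} (h : IsHaar A μ) (x y z w : Λ → Fin q) :
    ∫ U, U x y * star (U z w) ∂μ = ∏ i, if i ∈ S then
      (if x i = z i ∧ y i = w i then (q : ℂ)⁻¹ else 0) else
      (if x i = y i ∧ z i = w i then 1 else 0) := by
  have hH := isHaar_map_localBlock S hA h fun _ => 0
  set r : (Λ → Fin q) → ({i // i ∈ S} → Fin q) := fun x i => x i.1
  have hae : ∀ᵐ U ∂μ, U x y * star (U z w) =
      (if (∀ i ∉ S, x i = y i) ∧ ∀ i ∉ S, z i = w i then 1 else 0) *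
      (localBlock S (fun _ => 0) U (r x) (r y) * star (localBlock S (fun _ => 0) U (r z) (r w))) := by
    filter_upwards [h.ae_mem] with U hU
    obtain ⟨M, rfl⟩ := (mem_localCarrier_iff S).1 (hA ▸ hU.1 : U ∈ localCarrier Λ q S)
    simp only [localBlock_localLift, localLift_apply]
    split_ifs <;> simp_all [r]
  have hmap := integral_map (μ := μ) (measurable_localBlock S fun _ => (0 : Fin q)).aemeasurable
    (hH.integrable_entry_mul (r x) (r y) (r z) (r w)).aestronglyMeasurable
  rw [integral_congr_ae hae, integral_const_mul, ← hmap, hH.integral_entry_mul_top]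
  by_cases hall : ∀ i, if i ∈ S then x i = z i ∧ y i = w i else x i = y i ∧ z i = w i
  · have hin : ∀ i ∈ S, x i = z i ∧ y i = w i := fun i hi => by simpa [hi] using hall i
    have hout : ∀ i ∉ S, x i = y i ∧ z i = w i := fun i hi => by simpa [hi] using hall i
    rw [if_pos ⟨fun i hi => (hout i hi).1, fun i hi => (hout i hi).2⟩,
      if_pos ⟨funext fun i => (hin i i.2).1, funext fun i => (hin i i.2).2⟩]
    have : ∀ i, (if i ∈ S then (if x i = z i ∧ y i = w i then (q : ℂ)⁻¹ else 0) else
        (if x i = y i ∧ z i = w i then 1 else 0)) = if i ∈ S then (q : ℂ)⁻¹ else 1 := by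
      intro i
      by_cases hi : i ∈ S
      · simp [hi, hin i hi]
      · simp [hi, hout i hi]
    simp [this, Finset.prod_ite_mem]
  · push Not at hall
    obtain ⟨i, hi⟩ := hall
    rw [Finset.prod_eq_zero (Finset.mem_univ i)]
    · by_cases hiS : i ∈ S
      · rw [if_pos hiS] at hi
        rw [if_neg (c := r x = r z ∧ r y = r w), mul_zero]
        exact fun h' => hi ⟨congrFun h'.1 ⟨i, hiS⟩, congrFun h'.2 ⟨i, hiS⟩⟩
      · rw [if_neg hiS] at hi
        rw [if_neg, zero_mul]
        exact fun h' => hi ⟨h'.1 i hiS, h'.2 i hiS⟩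
    · split_ifs at hi ⊢ <;> simp_all

lemma sum_prod_pi₄ {ι κ R : Type*} [Fintype ι] [DecidableEq ι] [Fintype κ] [CommSemiring R]
    (g : ι → κ → κ → κ → κ → R) :
    ∑ x : ι → κ, ∑ y : ι → κ, ∑ z : ι → κ, ∑ w : ι → κ, ∏ i, g i (x i) (y i) (z i) (w i) =
      ∏ i, ∑ a, ∑ b, ∑ c, ∑ d, g i a b c d := by
  simp only [Fintype.prod_sum]

theorem MAN_local [NeZero q] (S₁ S₂ : Finset Λ)
    {A₁ A₂ : StarSubalgebra ℂ (Matrix (Λ → Fin q) (Λ → Fin q) ℂ)}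
    (h₁ : (A₁ : Set (Matrix (Λ → Fin q) (Λ → Fin q) ℂ)) = localCarrier Λ q S₁)
    (h₂ : (A₂ : Set (Matrix (Λ → Fin q) (Λ → Fin q) ℂ)) = localCarrier Λ q S₂)
    {μ ν : Measure (Matrix (Λ → Fin q) (Λ → Fin q) ℂ)} (hμ : IsHaar A₁ μ) (hν : IsHaar A₂ ν) :
    MAN μ ν = 1 - ((q : ℝ) ^ (2 * (S₁ ∩ S₂).card))⁻¹ := by
  have hq : (q : ℂ) ≠ 0 := NeZero.ne _
  rw [MAN_eq_of_isHaar hμ hν]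
  simp only [integral_entry_mul_local S₁ h₁ hμ, integral_entry_mul_local S₂ h₂ hν,
    ← Finset.prod_mul_distrib]
  rw [sum_prod_pi₄ fun i a b c d => (if i ∈ S₁ then
      (if d = c ∧ a = b then (q : ℂ)⁻¹ else 0) else (if d = a ∧ c = b then 1 else 0)) *
      (if i ∈ S₂ then (if c = b ∧ d = a then (q : ℂ)⁻¹ else 0) else
      (if c = d ∧ b = a then 1 else 0))]
  have hsite : ∀ i, (∑ a : Fin q, ∑ b : Fin q, ∑ c : Fin q, ∑ d : Fin q, (if i ∈ S₁ then
      (if d = c ∧ a = b then (q : ℂ)⁻¹ else 0) else (if d = a ∧ c = b then 1 else 0)) *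
      (if i ∈ S₂ then (if c = b ∧ d = a then (q : ℂ)⁻¹ else 0) else
      (if c = d ∧ b = a then 1 else 0))) = q * if i ∈ S₁ ∩ S₂ then ((q : ℂ) ^ 2)⁻¹ else 1 := by
    intro i
    by_cases hi₁ : i ∈ S₁ <;> by_cases hi₂ : i ∈ S₂ <;>
      simp [hi₁, hi₂, ite_and, Finset.sum_ite_eq, Finset.sum_ite_eq']
    field_simp
    simp
  simp only [hsite, Finset.prod_mul_distrib, Finset.prod_ite_mem, Finset.univ_inter,
    Finset.prod_const, Finset.card_univ]
  have hc : (q : ℂ) ^ Fintype.card Λ * ((q : ℂ) ^ 2)⁻¹ ^ (S₁ ∩ S₂).card =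
      (((q : ℝ) ^ Fintype.card Λ * ((q : ℝ) ^ (2 * (S₁ ∩ S₂).card))⁻¹ : ℝ) : ℂ) := by
    push_cast
    rw [inv_pow, pow_mul]
  have hqr : (q : ℝ) ≠ 0 := NeZero.ne _
  rw [hc, Complex.ofReal_re, Fintype.card_fun, Fintype.card_fin]
  push_cast
  field_simp

end Local

/-- `S(A_{S₁} : A_{S₂}) = 1 - q^{-2|S₁ ∩ S₂|}`; in particular
`S(A_S : A_S) = 1 - q^{-2|S|}`. -/
theorem stmt_12 (Λ : Type*) [Fintype Λ] [DecidableEq Λ] (q : ℕ) (hq : 2 ≤ q) :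
    (∀ S₁ S₂ : Finset Λ,
      ∀ A₁ A₂ : StarSubalgebra ℂ (Matrix (Λ → Fin q) (Λ → Fin q) ℂ),
      (A₁ : Set (Matrix (Λ → Fin q) (Λ → Fin q) ℂ)) = localCarrier Λ q S₁ →
      (A₂ : Set (Matrix (Λ → Fin q) (Λ → Fin q) ℂ)) = localCarrier Λ q S₂ →
      ∀ μ ν : Measure (Matrix (Λ → Fin q) (Λ → Fin q) ℂ),
        IsHaar A₁ μ → IsHaar A₂ ν →
        MAN μ ν = 1 - ((q : ℝ) ^ (2 * (S₁ ∩ S₂).card))⁻¹) ∧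
    (∀ S : Finset Λ,
      ∀ A : StarSubalgebra ℂ (Matrix (Λ → Fin q) (Λ → Fin q) ℂ),
      (A : Set (Matrix (Λ → Fin q) (Λ → Fin q) ℂ)) = localCarrier Λ q S →
      ∀ μ ν : Measure (Matrix (Λ → Fin q) (Λ → Fin q) ℂ),
        IsHaar A μ → IsHaar A ν →
        MAN μ ν = 1 - ((q : ℝ) ^ (2 * S.card))⁻¹) := by
  have : NeZero q := ⟨by omega⟩
  refine ⟨fun S₁ S₂ A₁ A₂ h₁ h₂ μ ν hμ hν => MAN_local S₁ S₂ h₁ h₂ hμ hν,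
    fun S A h μ ν hμ hν => ?_⟩
  simpa using MAN_local S S h h hμ hν
end
end

section
/- Let A, B be hermitian-closed unital subalgebras of M_d(ℂ) and assume A is collinear, i.e. dim_ℂ(A)·dim_ℂ(A') = d². Let P_A and P_{B'} be the orthogonal projections (with respect to the Frobenius inner product) of M_d(ℂ) onto A and onto the commutant B', viewed as ℂ-linear endomorphisms of M_d(ℂ). Then S(A : B) = 1 − (1/dim_ℂ(A)) · tr(P_A ∘ P_{B'}), where tr is the trace of a linear endomorphism of M_d(ℂ). -/
open MeasureTheory Matrix Kronecker

noncomputable section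

/-- The commutant `A' = {X : XY = YX ∀ Y ∈ A}` as a ℂ-subspace of matrix space. -/
def commSub {n : Type*} [Fintype n] [DecidableEq n] (A : StarSubalgebra ℂ (Matrix n n ℂ)) :
    Submodule ℂ (Matrix n n ℂ) where
  carrier := {X | ∀ Y ∈ A, X * Y = Y * X}
  add_mem' := by
    intro a b ha hb Y hY
    rw [add_mul, mul_add, ha Y hY, hb Y hY]
  zero_mem' := by
    intro Y hY
    rw [zero_mul, mul_zero]
  smul_mem' := by
    intro c X hX Y hY
    rw [smul_mul_assoc, hX Y hY, mul_smul_comm]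

section

open scoped Matrix.Norms.L2Operator ComplexOrder

section

variable {n : Type*} [Fintype n] [DecidableEq n]

instance matrixBorelSpace : BorelSpace (Matrix n n ℂ) :=
  inferInstanceAs (BorelSpace (n → n → ℂ))

theorem isCompact_unitary : IsCompact (unitary (Matrix n n ℂ) : Set (Matrix n n ℂ)) := by
  have : ProperSpace (Matrix n n ℂ) := FiniteDimensional.proper ℂ _
  refine Metric.isCompact_of_isClosed_isBounded isClosed_unitary ?_
  refine (Metric.isBounded_closedBall (x := (0 : Matrix n n ℂ)) (r := 1)).subset fun U hU => ?_
  cases subsingleton_or_nontrivial (Matrix n n ℂ)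
  · simp [Subsingleton.elim U 0]
  · simpa using (CStarRing.norm_of_mem_unitary hU).le

theorem trace_eq_sum_single (T : Matrix n n ℂ →ₗ[ℂ] Matrix n n ℂ) :
    LinearMap.trace ℂ _ T = ∑ i, ∑ j, T (single i j 1) i j := by
  rw [LinearMap.trace_eq_matrix_trace ℂ (Matrix.stdBasis ℂ n n), Matrix.trace,
    Fintype.sum_prod_type]
  simp [LinearMap.toMatrix_apply, Matrix.stdBasis, single_eq_of_single_single]

end

namespace IsHaar

variable {n : Type*} [Fintype n] [DecidableEq n] {A : StarSubalgebra ℂ (Matrix n n ℂ)}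
  {μ : Measure (Matrix n n ℂ)}

theorem mem_span_unitary {X : Matrix n n ℂ} (hX : X ∈ A) :
    X ∈ Submodule.span ℂ {U : Matrix n n ℂ | U ∈ A ∧ U ∈ unitary (Matrix n n ℂ)} := by
  have : IsClosed (A : Set (Matrix n n ℂ)) :=
    (Subalgebra.toSubmodule A.toSubalgebra).closed_of_finiteDimensional
  obtain ⟨u, c, h, -⟩ := CStarAlgebra.exists_sum_four_unitary (⟨X, hX⟩ : A)
  have h' : X = ∑ i, c i • ((u i : A) : Matrix n n ℂ) := by
    simpa using congrArg (Subtype.val : A → Matrix n n ℂ) h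
  rw [h']
  refine Submodule.sum_mem _ fun i _ =>
    Submodule.smul_mem _ _ (Submodule.subset_span ⟨(u i : A).2, ?_⟩)
  have h2 := (u i).2
  rw [Unitary.mem_iff] at h2 ⊢
  exact ⟨congrArg (Subtype.val : A → Matrix n n ℂ) h2.1,
    congrArg (Subtype.val : A → Matrix n n ℂ) h2.2⟩

theorem ae_mem_s16 (hμ : IsHaar A μ) : ∀ᵐ U ∂μ, U ∈ A ∧ U ∈ unitary (Matrix n n ℂ) := hμ.2.1

theorem integrable {E : Type*} [NormedAddCommGroup E] (hμ : IsHaar A μ)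
    {f : Matrix n n ℂ → E} (hf : Continuous f) : Integrable f μ := by
  have := hμ.1
  rw [← Measure.restrict_eq_self_of_ae_mem (hμ.ae_mem_s16.mono fun _ h => h.2)]
  exact hf.continuousOn.integrableOn_compact isCompact_unitary

theorem integral_mul_left_s16 {E : Type*} [NormedAddCommGroup E] [NormedSpace ℝ E]
    (hμ : IsHaar A μ) {f : Matrix n n ℂ → E} (hf : Continuous f) {W : Matrix n n ℂ}
    (hW : W ∈ A) (hWu : W ∈ unitary (Matrix n n ℂ)) :
    ∫ U, f (W * U) ∂μ = ∫ U, f U ∂μ := by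
  have hm : Continuous fun U : Matrix n n ℂ => W * U := by fun_prop
  conv_rhs => rw [← hμ.2.2 W hW hWu]
  refine (integral_map hm.aemeasurable ?_).symm
  rw [hμ.2.2 W hW hWu]
  exact (hμ.integrable hf).aestronglyMeasurable

theorem map_integral {E F : Type*} [NormedAddCommGroup E] [NormedSpace ℂ E]
    [FiniteDimensional ℂ E] [NormedAddCommGroup F] [NormedSpace ℂ F] [FiniteDimensional ℂ F]
    (hμ : IsHaar A μ) (L : E →ₗ[ℂ] F) {f : Matrix n n ℂ → E} (hf : Continuous f) :
    L (∫ U, f U ∂μ) = ∫ U, L (f U) ∂μ := by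
  have : CompleteSpace E := FiniteDimensional.complete ℂ E
  have : CompleteSpace F := FiniteDimensional.complete ℂ F
  exact (L.toContinuousLinearMap.integral_comp_comm (hμ.integrable hf)).symm

/-- The averaging map `X ↦ ∫ U X U† dU` over the unitaries of `A`. -/
def twirl (hμ : IsHaar A μ) : Matrix n n ℂ →ₗ[ℂ] Matrix n n ℂ where
  toFun X := ∫ U, U * X * Uᴴ ∂μ
  map_add' X Y := by
    simp only [mul_add, add_mul]
    exact integral_add (hμ.integrable (by fun_prop)) (hμ.integrable (by fun_prop))
  map_smul' c X := by
    simp only [mul_smul_comm, smul_mul_assoc, RingHom.id_apply]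
    exact integral_smul c _

/-- The frame operator `X ↦ ∫ Tr(U† X) U dU` of the unitaries of `A`. -/
def frameOp (hμ : IsHaar A μ) : Matrix n n ℂ →ₗ[ℂ] Matrix n n ℂ where
  toFun X := ∫ U, trace (Uᴴ * X) • U ∂μ
  map_add' X Y := by
    simp only [mul_add, trace_add, add_smul]
    exact integral_add (hμ.integrable (by fun_prop)) (hμ.integrable (by fun_prop))
  map_smul' c X := by
    simp only [mul_smul_comm, trace_smul, RingHom.id_apply, smul_assoc]
    exact integral_smul c _

theorem twirl_apply (hμ : IsHaar A μ) (X : Matrix n n ℂ) :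
    hμ.twirl X = ∫ U, U * X * Uᴴ ∂μ := rfl

theorem frameOp_apply (hμ : IsHaar A μ) (X : Matrix n n ℂ) :
    hμ.frameOp X = ∫ U, trace (Uᴴ * X) • U ∂μ := rfl

theorem trace_mul_twirl (hμ : IsHaar A μ) (Y X : Matrix n n ℂ) :
    trace (Y * hμ.twirl X) = ∫ U, trace (Y * (U * X * Uᴴ)) ∂μ :=
  hμ.map_integral (traceLinearMap n ℂ ℂ ∘ₗ LinearMap.mulLeft ℂ Y)
    (f := fun U => U * X * Uᴴ) (by fun_prop)

theorem twirl_mul_comm (hμ : IsHaar A μ) (X : Matrix n n ℂ) {Y : Matrix n n ℂ} (hY : Y ∈ A) :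
    hμ.twirl X * Y = Y * hμ.twirl X := by
  have hY' := mem_span_unitary hY
  clear hY
  induction hY' using Submodule.span_induction with
  | mem W hW =>
    have h : W * hμ.twirl X * Wᴴ = hμ.twirl X := by
      have h1 := hμ.map_integral (LinearMap.mulRight ℂ Wᴴ ∘ₗ LinearMap.mulLeft ℂ W)
        (f := fun U => U * X * Uᴴ) (by fun_prop)
      have h2 := hμ.integral_mul_left_s16 (f := fun U => U * X * Uᴴ) (by fun_prop) hW.1 hW.2
      simp only [LinearMap.comp_apply, LinearMap.mulLeft_apply, LinearMap.mulRight_apply] at h1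
      rw [twirl_apply, h1, ← h2]
      simp only [conjTranspose_mul, mul_assoc]
    have hWW : Wᴴ * W = 1 := (Unitary.mem_iff.1 hW.2).1
    conv_lhs => rw [← h, mul_assoc, hWW, mul_one]
  | zero => simp
  | add _ _ _ _ h₁ h₂ => rw [mul_add, add_mul, h₁, h₂]
  | smul c _ _ h => rw [mul_smul_comm, smul_mul_assoc, h]

theorem twirl_of_comm (hμ : IsHaar A μ) {X : Matrix n n ℂ} (hX : ∀ Y ∈ A, X * Y = Y * X) :
    hμ.twirl X = X := by
  have := hμ.1
  rw [twirl_apply, integral_congr_ae (g := fun _ => X)]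
  · simp
  · filter_upwards [hμ.ae_mem_s16] with U hU
    rw [← hX U hU.1, mul_assoc, show U * Uᴴ = 1 from (Unitary.mem_iff.1 hU.2).2, mul_one]

theorem twirl_isProj (hμ : IsHaar A μ) : LinearMap.IsProj (commSub A) hμ.twirl :=
  ⟨fun X _ hY => hμ.twirl_mul_comm X hY, fun _ hX => hμ.twirl_of_comm hX⟩

theorem trace_twirl (hμ : IsHaar A μ) :
    LinearMap.trace ℂ _ hμ.twirl = Module.finrank ℂ (commSub A) :=
  hμ.twirl_isProj.trace

theorem trace_conjTranspose_mul_twirl (hμ : IsHaar A μ) {X Y : Matrix n n ℂ}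
    (hY : ∀ Z ∈ A, Y * Z = Z * Y) : trace (Yᴴ * hμ.twirl X) = trace (Yᴴ * X) := by
  have := hμ.1
  rw [trace_mul_twirl, integral_congr_ae (g := fun _ => trace (Yᴴ * X))]
  · simp
  · filter_upwards [hμ.ae_mem_s16] with U hU
    have h : Yᴴ * U = U * Yᴴ := by
      have := congrArg conjTranspose (hY Uᴴ (star_mem hU.1))
      simpa using this.symm
    have hUU : Uᴴ * U = 1 := (Unitary.mem_iff.1 hU.2).1
    rw [show Yᴴ * (U * X * Uᴴ) = U * (Yᴴ * X * Uᴴ) by simp only [← mul_assoc, h],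
      trace_mul_comm, mul_assoc, hUU, mul_one]

theorem twirl_eq_orthogonal_projection (hμ : IsHaar A μ) {P : Matrix n n ℂ →ₗ[ℂ] Matrix n n ℂ}
    (hP₁ : ∀ X, ∀ Y ∈ A, P X * Y = Y * P X)
    (hP₂ : ∀ X Y : Matrix n n ℂ, (∀ Z ∈ A, Y * Z = Z * Y) → trace (Yᴴ * (X - P X)) = 0) :
    hμ.twirl = P := by
  ext1 X
  have hc : ∀ Y ∈ A, hμ.twirl (X - P X) * Y = Y * hμ.twirl (X - P X) :=
    fun Y hY => hμ.twirl_mul_comm _ hY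
  have h := hμ.trace_conjTranspose_mul_twirl (X := X - P X) hc
  rw [hP₂ X _ hc, trace_conjTranspose_mul_self_eq_zero_iff, map_sub,
    hμ.twirl_of_comm (hP₁ X), sub_eq_zero] at h
  exact h

theorem trace_comp_frameOp (hμ : IsHaar A μ) (T : Matrix n n ℂ →ₗ[ℂ] Matrix n n ℂ) :
    LinearMap.trace ℂ _ (T ∘ₗ hμ.frameOp) = ∫ U, trace (Uᴴ * T U) ∂μ := by
  have hT : Continuous T := T.continuous_of_finiteDimensional
  have h (i j : n) : (T ∘ₗ hμ.frameOp) (single i j 1) i j = ∫ U, Uᴴ j i * T U i j ∂μ := by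
    have := hμ.map_integral (Matrix.entryLinearMap ℂ ℂ i j ∘ₗ T)
      (f := fun U => trace (Uᴴ * single i j 1) • U) (by fun_prop)
    simpa [frameOp_apply, trace_mul_single] using this
  have hint (i j : n) : Integrable (fun U : Matrix n n ℂ => Uᴴ j i * T U i j) μ :=
    hμ.integrable (((continuous_id.matrix_conjTranspose).matrix_elem j i).mul (hT.matrix_elem i j))
  simp only [trace_eq_sum_single, h]
  simp only [← integral_finsetSum, hint, implies_true, integrable_finsetSum]
  congr 1 with U
  rw [Finset.sum_comm]
  simp [Matrix.trace, Matrix.mul_apply]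

theorem trace_frameOp (hμ : IsHaar A μ) :
    LinearMap.trace ℂ _ hμ.frameOp = Fintype.card n := by
  have := hμ.1
  have h := hμ.trace_comp_frameOp LinearMap.id
  rw [LinearMap.id_comp] at h
  rw [h, integral_congr_ae (g := fun _ => (Fintype.card n : ℂ))]
  · simp
  · filter_upwards [hμ.ae_mem_s16] with U hU
    have hUU : Uᴴ * U = 1 := (Unitary.mem_iff.1 hU.2).1
    simp [hUU]

theorem trace_twirl_eq_integral (hμ : IsHaar A μ) :
    LinearMap.trace ℂ _ hμ.twirl = ∫ U, trace Uᴴ * trace U ∂μ := by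
  have h (i j : n) : hμ.twirl (single i j 1) i j = ∫ U, Uᴴ j j * U i i ∂μ := by
    have := hμ.map_integral (Matrix.entryLinearMap ℂ ℂ i j)
      (f := fun U => U * single i j 1 * Uᴴ) (by fun_prop)
    rw [twirl_apply]
    refine this.trans ?_
    congr 1 with U
    simp [Matrix.mul_apply, Matrix.single_apply, ite_and, mul_comm]
  have hint (i j : n) : Integrable (fun U : Matrix n n ℂ => Uᴴ j j * U i i) μ :=
    hμ.integrable (((continuous_id.matrix_conjTranspose).matrix_elem j j).mul
      (continuous_id.matrix_elem i i))
  simp only [trace_eq_sum_single, h]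
  simp only [← integral_finsetSum, hint, implies_true, integrable_finsetSum]
  congr 1 with U
  rw [Finset.sum_comm]
  simp [Matrix.trace, Finset.sum_mul_sum]

theorem trace_mul_frameOp (hμ : IsHaar A μ) (Y X : Matrix n n ℂ) :
    trace (Y * hμ.frameOp X) = ∫ U, trace (Uᴴ * X) * trace (Y * U) ∂μ := by
  have := hμ.map_integral (traceLinearMap n ℂ ℂ ∘ₗ LinearMap.mulLeft ℂ Y)
    (f := fun U => trace (Uᴴ * X) • U) (by fun_prop)
  simpa [frameOp_apply] using this

theorem trace_frameOp_comp_frameOp (hμ : IsHaar A μ) :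
    LinearMap.trace ℂ _ (hμ.frameOp ∘ₗ hμ.frameOp) = Module.finrank ℂ (commSub A) := by
  have := hμ.1
  rw [trace_comp_frameOp, ← hμ.trace_twirl, trace_twirl_eq_integral,
    integral_congr_ae (g := fun _ => ∫ V, trace Vᴴ * trace V ∂μ)]
  · simp
  · filter_upwards [hμ.ae_mem_s16] with U hU
    have hUU : Uᴴ * U = 1 := (Unitary.mem_iff.1 hU.2).1
    rw [trace_mul_frameOp, ← hμ.integral_mul_left_s16 _ hU.1 hU.2]
    · congr 1 with V
      rw [conjTranspose_mul, mul_assoc, hUU, mul_one, ← mul_assoc, hUU, one_mul]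
    · fun_prop

theorem frameOp_selfAdjoint (hμ : IsHaar A μ) (X Y : Matrix n n ℂ) :
    trace (Yᴴ * hμ.frameOp X) = trace ((hμ.frameOp Y)ᴴ * X) := by
  have h : (hμ.frameOp Y)ᴴ * X = (Xᴴ * hμ.frameOp Y)ᴴ := by simp
  rw [h, trace_conjTranspose, trace_mul_frameOp, trace_mul_frameOp, ← starRingEnd_apply,
    ← integral_conj]
  congr 1 with U
  rw [map_mul, starRingEnd_apply, starRingEnd_apply, ← trace_conjTranspose,
    ← trace_conjTranspose, mul_comm]
  simp

theorem comp_frameOp (hμ : IsHaar A μ) {P : Matrix n n ℂ →ₗ[ℂ] Matrix n n ℂ}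
    (hP : ∀ X ∈ A, P X = X) : P ∘ₗ hμ.frameOp = hμ.frameOp := by
  ext1 X
  rw [LinearMap.comp_apply, frameOp_apply, hμ.map_integral P (by fun_prop)]
  refine integral_congr_ae ?_
  filter_upwards [hμ.ae_mem_s16] with U hU
  rw [map_smul, hP U hU.1]

end IsHaar

/-- A linear map that is symmetric for the Frobenius inner product and whose square is traceless
vanishes. -/
theorem eq_zero_of_symmetric_of_trace_comp_self {n : Type*} [Fintype n] [DecidableEq n]
    {T : Matrix n n ℂ →ₗ[ℂ] Matrix n n ℂ}
    (hT : ∀ X Y, trace (Yᴴ * T X) = trace ((T Y)ᴴ * X))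
    (h0 : LinearMap.trace ℂ _ (T ∘ₗ T) = 0) : T = 0 := by
  have h (i j : n) : (T ∘ₗ T) (single i j 1) i j =
      trace ((T (single i j 1))ᴴ * T (single i j 1)) := by
    rw [← hT]
    simp [trace_single_mul]
  have hnn (i j : n) : 0 ≤ trace ((T (single i j 1))ᴴ * T (single i j 1)) :=
    (posSemidef_conjTranspose_mul_self _).trace_nonneg
  simp only [trace_eq_sum_single, h] at h0
  refine Matrix.ext_linearMap ℂ fun i j => ?_
  ext1
  have h1 := (Finset.sum_eq_zero_iff_of_nonneg
    fun i _ => Finset.sum_nonneg fun j _ => hnn i j).1 h0 i (Finset.mem_univ i)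
  have h2 := (Finset.sum_eq_zero_iff_of_nonneg fun j _ => hnn i j).1 h1 j (Finset.mem_univ j)
  simpa [trace_conjTranspose_mul_self_eq_zero_iff] using h2

section Projection

variable {n : Type*} [Fintype n] [DecidableEq n] {A B : StarSubalgebra ℂ (Matrix n n ℂ)}
  {μ ν : Measure (Matrix n n ℂ)} {P Q : Matrix n n ℂ →ₗ[ℂ] Matrix n n ℂ}

theorem orthogonal_projection_eq_self (hP₁ : ∀ X, P X ∈ A)
    (hP₂ : ∀ X, ∀ Y ∈ A, trace (Yᴴ * (X - P X)) = 0) : ∀ X ∈ A, P X = X := by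
  intro X hX
  have h := hP₂ X _ (sub_mem hX (hP₁ X))
  rw [trace_conjTranspose_mul_self_eq_zero_iff, sub_eq_zero] at h
  exact h.symm

theorem orthogonal_projection_symmetric (hP₁ : ∀ X, P X ∈ A)
    (hP₂ : ∀ X, ∀ Y ∈ A, trace (Yᴴ * (X - P X)) = 0) (X Y : Matrix n n ℂ) :
    trace (Yᴴ * P X) = trace ((P Y)ᴴ * X) := by
  have h1 := hP₂ X _ (hP₁ Y)
  have h2 := congrArg star (hP₂ Y _ (hP₁ X))
  rw [← trace_conjTranspose, conjTranspose_mul, conjTranspose_conjTranspose, star_zero,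
    conjTranspose_sub, sub_mul, trace_sub, sub_eq_zero] at h2
  rw [mul_sub, trace_sub, sub_eq_zero] at h1
  rw [h1, h2]

theorem trace_orthogonal_projection (hP₁ : ∀ X, P X ∈ A)
    (hP₂ : ∀ X, ∀ Y ∈ A, trace (Yᴴ * (X - P X)) = 0) :
    LinearMap.trace ℂ _ P = Module.finrank ℂ (Subalgebra.toSubmodule A.toSubalgebra) :=
  LinearMap.IsProj.trace ⟨hP₁, orthogonal_projection_eq_self hP₁ hP₂⟩

/-- For a collinear algebra, the frame operator of its unitaries is a multiple of the orthogonal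
projection onto it. -/
theorem IsHaar.frameOp_eq_smul [Nonempty n] (hμ : IsHaar A μ)
    (hcol : Module.finrank ℂ (Subalgebra.toSubmodule A.toSubalgebra) *
      Module.finrank ℂ (commSub A) = Fintype.card n ^ 2)
    (hP₁ : ∀ X, P X ∈ A) (hP₂ : ∀ X, ∀ Y ∈ A, trace (Yᴴ * (X - P X)) = 0) :
    hμ.frameOp = ((Fintype.card n : ℂ) /
      Module.finrank ℂ (Subalgebra.toSubmodule A.toSubalgebra)) • P := by
  have hP := orthogonal_projection_eq_self hP₁ hP₂
  have htr := trace_orthogonal_projection hP₁ hP₂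
  set a := Module.finrank ℂ (Subalgebra.toSubmodule A.toSubalgebra)
  set c := Module.finrank ℂ (commSub A)
  have hcol' : (a : ℂ) * c = (Fintype.card n : ℂ) ^ 2 := by exact_mod_cast hcol
  have ha : (a : ℂ) ≠ 0 := by
    rintro h
    rw [h, zero_mul, eq_comm] at hcol'
    simp at hcol'
  set l : ℂ := (Fintype.card n : ℂ) / a with hl
  have hl_star : star l = l := by simp [hl]
  rw [← sub_eq_zero]
  refine eq_zero_of_symmetric_of_trace_comp_self (fun X Y => ?_) ?_
  · simp only [LinearMap.sub_apply, LinearMap.smul_apply, mul_sub, conjTranspose_sub, sub_mul,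
      trace_sub, conjTranspose_smul, hl_star, mul_smul_comm, smul_mul_assoc, trace_smul,
      hμ.frameOp_selfAdjoint X Y, orthogonal_projection_symmetric hP₁ hP₂ X Y]
  · have hPP : P ∘ₗ P = P := LinearMap.ext fun X => hP _ (hP₁ X)
    have hPF := hμ.comp_frameOp hP
    have hFP : LinearMap.trace ℂ _ (hμ.frameOp ∘ₗ P) = Fintype.card n := by
      rw [LinearMap.trace_comp_comm', hPF, hμ.trace_frameOp]
    simp only [LinearMap.sub_comp, LinearMap.comp_sub, LinearMap.smul_comp, LinearMap.comp_smul,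
      map_sub, map_smul, hPP, hPF, hFP, htr, hμ.trace_frameOp, hμ.trace_frameOp_comp_frameOp,
      smul_eq_mul]
    change (c : ℂ) - _ - _ = 0
    rw [hl]
    field_simp
    linear_combination hcol'

theorem hs2_commutator {U V : Matrix n n ℂ} (hU : U ∈ unitary (Matrix n n ℂ))
    (hV : V ∈ unitary (Matrix n n ℂ)) :
    hs2 (U * V - V * U) = 2 * Fintype.card n - 2 * (trace (Uᴴ * (V * U * Vᴴ))).re := by
  have hUU : Uᴴ * U = 1 := (Unitary.mem_iff.1 hU).1
  have hVV : Vᴴ * V = 1 := (Unitary.mem_iff.1 hV).1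
  have h1 : trace ((U * V)ᴴ * (U * V)) = Fintype.card n := by
    rw [conjTranspose_mul, mul_assoc, ← mul_assoc Uᴴ, hUU, one_mul, hVV, trace_one]
  have h2 : trace ((V * U)ᴴ * (V * U)) = Fintype.card n := by
    rw [conjTranspose_mul, mul_assoc, ← mul_assoc Vᴴ, hVV, one_mul, hUU, trace_one]
  have h3 : trace ((U * V)ᴴ * (V * U)) = trace (Uᴴ * (V * U * Vᴴ)) := by
    rw [conjTranspose_mul, mul_assoc, trace_mul_comm]
    simp only [mul_assoc]
  have h4 : trace ((V * U)ᴴ * (U * V)) = star (trace (Uᴴ * (V * U * Vᴴ))) := by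
    rw [← h3, ← trace_conjTranspose]
    simp
  rw [hs2, conjTranspose_sub, sub_mul, mul_sub, mul_sub, trace_sub, trace_sub, trace_sub, h1, h2,
    h3, h4]
  simp
  ring

theorem integral_hs2_commutator (hν : IsHaar B ν) {U : Matrix n n ℂ}
    (hU : U ∈ unitary (Matrix n n ℂ)) :
    ∫ V, hs2 (U * V - V * U) ∂ν = 2 * Fintype.card n - 2 * (trace (Uᴴ * hν.twirl U)).re := by
  have := hν.1
  have hi : Integrable (fun V : Matrix n n ℂ => trace (Uᴴ * (V * U * Vᴴ))) ν :=
    hν.integrable (by fun_prop)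
  rw [hν.trace_mul_twirl, integral_congr_ae
    (g := fun V => 2 * (Fintype.card n : ℝ) - 2 * (trace (Uᴴ * (V * U * Vᴴ))).re)]
  · have hr : Integrable (fun V : Matrix n n ℂ => (trace (Uᴴ * (V * U * Vᴴ))).re) ν := hi.re
    rw [integral_sub (integrable_const _) (hr.const_mul 2), integral_const_mul, integral_const_mul,
      show ∫ V, (trace (Uᴴ * (V * U * Vᴴ))).re ∂ν = _ from integral_re hi]
    simp
  · filter_upwards [hν.ae_mem_s16] with V hV using hs2_commutator hU hV.2

theorem MAN_eq [Nonempty n] (hμ : IsHaar A μ) (hν : IsHaar B ν) :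
    MAN μ ν = 1 - (LinearMap.trace ℂ _ (hν.twirl ∘ₗ hμ.frameOp)).re / Fintype.card n := by
  have := hμ.1
  have hc : Continuous hν.twirl := hν.twirl.continuous_of_finiteDimensional
  have hi : Integrable (fun U : Matrix n n ℂ => trace (Uᴴ * hν.twirl U)) μ :=
    hμ.integrable (by fun_prop)
  rw [MAN, hμ.trace_comp_frameOp, integral_congr_ae
    (g := fun U => 2 * Fintype.card n - 2 * (trace (Uᴴ * hν.twirl U)).re)]
  · have hr : Integrable (fun U : Matrix n n ℂ => (trace (Uᴴ * hν.twirl U)).re) μ := hi.re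
    rw [integral_sub (integrable_const _) (hr.const_mul 2), integral_const_mul, integral_const_mul,
      show ∫ U, (trace (Uᴴ * hν.twirl U)).re ∂μ = _ from integral_re hi]
    simp only [integral_const, probReal_univ, one_smul, RCLike.re_eq_complex_re]
    field_simp
  · filter_upwards [hμ.ae_mem_s16] with U hU using integral_hs2_commutator hν hU.2

theorem trace_twirl_comp_frameOp_im (hμ : IsHaar A μ) (hν : IsHaar B ν) :
    (LinearMap.trace ℂ _ (hν.twirl ∘ₗ hμ.frameOp)).im = 0 := by
  have h (U : Matrix n n ℂ) :
      trace ((hν.twirl U)ᴴ * hν.twirl U) = trace (Uᴴ * hν.twirl U) := by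
    have h1 := hν.trace_conjTranspose_mul_twirl (X := U) (Y := hν.twirl U)
      fun Z hZ => hν.twirl_mul_comm U hZ
    have h2 := congrArg star h1
    simpa only [← trace_conjTranspose, conjTranspose_mul, conjTranspose_conjTranspose] using h2
  rw [← Complex.conj_eq_iff_im, hμ.trace_comp_frameOp, ← integral_conj]
  congr 1 with U
  rw [← h, starRingEnd_apply, ← trace_conjTranspose]
  simp

end Projection

end

/-- For `A` collinear (`dim A · dim A' = d²`):
`S(A:B) = 1 - (1/dim A) tr(P_A ∘ P_{B'})`. -/
theorem stmt_16 (d : ℕ) (hd : 0 < d)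
    (A B : StarSubalgebra ℂ (Matrix (Fin d) (Fin d) ℂ))
    (hcol : Module.finrank ℂ ↥(Subalgebra.toSubmodule A.toSubalgebra) *
      Module.finrank ℂ ↥(commSub A) = d ^ 2)
    (PA PB : Matrix (Fin d) (Fin d) ℂ →ₗ[ℂ] Matrix (Fin d) (Fin d) ℂ)
    (hPA1 : ∀ X, PA X ∈ A)
    (hPA2 : ∀ X, ∀ Y ∈ A, Matrix.trace (Yᴴ * (X - PA X)) = 0)
    (hPB1 : ∀ X, ∀ Y ∈ B, PB X * Y = Y * PB X)
    (hPB2 : ∀ X (Y : Matrix (Fin d) (Fin d) ℂ), (∀ Z ∈ B, Y * Z = Z * Y) →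
      Matrix.trace (Yᴴ * (X - PB X)) = 0)
    (μ ν : Measure (Matrix (Fin d) (Fin d) ℂ))
    (hμ : IsHaar A μ) (hν : IsHaar B ν) :
    (MAN μ ν : ℂ) = 1 -
      (1 / (Module.finrank ℂ ↥(Subalgebra.toSubmodule A.toSubalgebra) : ℂ)) *
        LinearMap.trace ℂ (Matrix (Fin d) (Fin d) ℂ) (PA ∘ₗ PB) := by
  have : Nonempty (Fin d) := ⟨⟨0, hd⟩⟩
  have hF := hμ.frameOp_eq_smul (by simpa using hcol) hPA1 hPA2
  have hE := hν.twirl_eq_orthogonal_projection hPB1 hPB2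
  have him := trace_twirl_comp_frameOp_im hμ hν
  have hre : ((LinearMap.trace ℂ _ (hν.twirl ∘ₗ hμ.frameOp)).re : ℂ) =
      LinearMap.trace ℂ _ (hν.twirl ∘ₗ hμ.frameOp) := Complex.ext rfl (by simp [him])
  have hd' : (d : ℂ) ≠ 0 := by exact_mod_cast hd.ne'
  rw [MAN_eq hμ hν]
  push_cast
  rw [hre, hE, hF, LinearMap.comp_smul, map_smul, LinearMap.trace_comp_comm']
  simp only [Fintype.card_fin, smul_eq_mul]
  field_simp
end
end
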